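/- Let λ, μ ∈ ℂ \ {0}, α, β ∈ ℂ and let (h^{(i)})_{i≥0}, (e^{(i)})_{i≥0} be finitely supported sequences of complex numbers, with associated polynomials h_n, e_n. Then the W(0,1)-modules Φ(λ,α,h) and Φ(μ,β,e) are isomorphic if and only if λ = μ, α = β, and h_n = e_n for all n ∈ ℤ. -/

import Mathlib

open MvPolynomial

noncomputable section

/-- The polynomial ring `ℂ[s,t]`, realized as `MvPolynomial (Fin 2) ℂ`
with `s = X 0` and `t = X 1`. -/
abbrev R2 : Type := MvPolynomial (Fin 2) ℂ

/-- The substitution `f(s,t) ↦ f(s-m,t)`, as a `ℂ`-linear map on `ℂ[s,t]`. -/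
def shiftS (m : ℤ) : R2 →ₗ[ℂ] R2 :=
  (aeval (fun i : Fin 2 => if i = 0 then (X 0 - C (m : ℂ) : R2) else (X 1 : R2))).toLinearMap

/-- Multiplication by a fixed polynomial, as a `ℂ`-linear map. -/
def mulBy (p : R2) : R2 →ₗ[ℂ] R2 := LinearMap.mulLeft ℂ p

/-- The partial derivative `∂/∂t`, as a `ℂ`-linear map. -/
def dT : R2 →ₗ[ℂ] R2 := (pderiv (1 : Fin 2)).toLinearMap

/-- Kronecker delta on `ℂ`. -/
def dlt (x y : ℂ) : ℂ := if x = y then 1 else 0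

/-- `q_{n,k;α}(t) = n t^k − δ_{b,−1} n(n−1)α Σ_{j=0}^{k−1} α^{k−1−j} t^j
− δ_{b,1} n α Σ_{j=0}^{k−1} α^{k−1−j} t^j`. -/
def qpoly (b α : ℂ) (n : ℤ) (k : ℕ) : R2 :=
  (n : ℂ) • ((X 1 : R2) ^ k)
    - (dlt b (-1) * (n : ℂ) * ((n : ℂ) - 1) * α) •
        ∑ j ∈ Finset.range k, (C (α ^ (k - 1 - j)) * (X 1 : R2) ^ j)
    - (dlt b 1 * (n : ℂ) * α) •
        ∑ j ∈ Finset.range k, (C (α ^ (k - 1 - j)) * (X 1 : R2) ^ j)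

/-- `h_n(t) = Σ_i h^{(i)} q_{n,i;α}(t)` for a finitely supported sequence `h`. -/
def hpol (b α : ℂ) (h : ℕ →₀ ℂ) (n : ℤ) : R2 := h.sum fun i c => c • qpoly b α n i

/-- The polynomial `t − δ_{b,−1} mα − δ_{b,1}(1−δ_{m,0})α`. -/
def wcoef (b α : ℂ) (m : ℤ) : R2 :=
  X 1 - C (dlt b (-1) * (m : ℂ) * α + dlt b 1 * (if m = 0 then 0 else 1) * α)

/-- The operator `W_m` of the module `Φ(λ,α,h)`:
`W_m · f(s,t) = λ^m (t − δ_{b,−1} mα − δ_{b,1}(1−δ_{m,0})α) f(s−m,t)`. -/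
def PhiW (b lam α : ℂ) (m : ℤ) : R2 →ₗ[ℂ] R2 :=
  mulBy (C (lam ^ m) * wcoef b α m) ∘ₗ shiftS m

/-- The operator `L_m` of the module `Φ(λ,α,h)`:
`L_m · f(s,t) = λ^m (s + h_m(t)) f(s−m,t)
 + b m λ^m (t − δ_{b,−1} mα − δ_{b,1}(1−δ_{m,0})α) (∂f/∂t)(s−m,t)`. -/
def PhiL (b lam α : ℂ) (h : ℕ →₀ ℂ) (m : ℤ) : R2 →ₗ[ℂ] R2 :=
  mulBy (C (lam ^ m) * (X 0 + hpol b α h m)) ∘ₗ shiftS m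
    + (b * (m : ℂ) * lam ^ m) • (mulBy (wcoef b α m) ∘ₗ (shiftS m ∘ₗ dT))

/-- `r_m(t) = Σ_i r^{(i)} m t^i` for a finitely supported sequence `r`. -/
def rpol (r : ℕ →₀ ℂ) (m : ℤ) : R2 := r.sum fun i c => (c * (m : ℂ)) • ((X 1 : R2) ^ i)

/-- The operator `L_m` of the module `Θ(λ,r)`:
`L_m · f(s,t) = λ^m (s + r_m(t)) f(s−m,t)`. -/
def ThetaL (lam : ℂ) (r : ℕ →₀ ℂ) (m : ℤ) : R2 →ₗ[ℂ] R2 :=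
  mulBy (C (lam ^ m) * (X 0 + rpol r m)) ∘ₗ shiftS m

/-- The operator `W_m` of the module `Θ(λ,r)`: `W_m · f(s,t) = δ_{m,0} t f(s,t)`. -/
def ThetaW (m : ℤ) : R2 →ₗ[ℂ] R2 := if m = 0 then mulBy (X 1) else 0

theorem shiftS_zero (f : R2) : shiftS 0 f = f := by
  have : (fun i : Fin 2 => if i = 0 then (X 0 - C ((0 : ℤ) : ℂ) : R2) else (X 1 : R2)) = X := by
    funext i
    fin_cases i <;> simp
  simp only [shiftS, AlgHom.toLinearMap_apply, this, aeval_X_left_apply]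

theorem shiftS_C (m : ℤ) (c : ℂ) : shiftS m (C c : R2) = C c := by
  simp [shiftS, algebraMap_eq]

theorem hpol_zero_index (b α : ℂ) (h : ℕ →₀ ℂ) : hpol b α h 0 = 0 := by
  simp [hpol, qpoly]

theorem wcoef_one_zero (α : ℂ) : wcoef 1 α 0 = X 1 := by
  simp [wcoef]

theorem wcoef_one_of_ne (α : ℂ) {m : ℤ} (hm : m ≠ 0) : wcoef 1 α m = X 1 - C α := by
  have h : (1 : ℂ) ≠ -1 := by norm_num
  simp [wcoef, dlt, hm, h]

theorem PhiL_zero_apply (b lam α : ℂ) (h : ℕ →₀ ℂ) (f : R2) : PhiL b lam α h 0 f = X 0 * f := by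
  simp [PhiL, mulBy, hpol_zero_index, shiftS_zero]

theorem PhiW_one_zero_apply (lam α : ℂ) (f : R2) : PhiW 1 lam α 0 f = X 1 * f := by
  simp [PhiW, mulBy, wcoef_one_zero, shiftS_zero]

theorem PhiL_apply_C (b lam α : ℂ) (h : ℕ →₀ ℂ) (m : ℤ) (c : ℂ) :
    PhiL b lam α h m (C c) = C (lam ^ m) * (X 0 + hpol b α h m) * C c := by
  simp [PhiL, mulBy, dT, shiftS_C, mul_assoc]

theorem PhiW_apply_C (b lam α : ℂ) (m : ℤ) (c : ℂ) :
    PhiW b lam α m (C c) = C (lam ^ m) * wcoef b α m * C c := by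
  simp [PhiW, mulBy, shiftS_C, mul_assoc]

/-- A linear endomorphism of a polynomial ring that commutes with multiplication by each variable
is multiplication by its value at `1`. -/
theorem linearMap_apply_eq_mul_apply_one {σ R : Type*} [CommSemiring R]
    (φ : MvPolynomial σ R →ₗ[R] MvPolynomial σ R) (hφ : ∀ i f, φ (X i * f) = X i * φ f)
    (f : MvPolynomial σ R) : φ f = f * φ 1 := by
  induction f using MvPolynomial.induction_on with
  | C a => rw [← mul_one (C a), ← smul_eq_C_mul, map_smul, smul_mul_assoc, one_mul]
  | add p q hp hq => rw [map_add, hp, hq, add_mul]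
  | mul_X p i hp => rw [mul_comm p, hφ, hp, mul_assoc]

/-- A bijective linear endomorphism of a polynomial ring over a domain that commutes with
multiplication by each variable is multiplication by a nonzero constant. -/
theorem exists_C_mul_of_linearEquiv {σ R : Type*} [CommRing R] [IsDomain R]
    (φ : MvPolynomial σ R ≃ₗ[R] MvPolynomial σ R) (hφ : ∀ i f, φ (X i * f) = X i * φ f) :
    ∃ c : R, c ≠ 0 ∧ ∀ f, φ f = f * C c := by
  have key : ∀ f, φ f = f * φ 1 := linearMap_apply_eq_mul_apply_one φ.toLinearMap hφ
  obtain ⟨g, hg⟩ := φ.surjective 1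
  rw [key] at hg
  obtain ⟨c, hc, hcφ⟩ :=
    MvPolynomial.isUnit_iff_eq_C_of_isReduced.mp (IsUnit.of_mul_eq_one_right g hg)
  exact ⟨c, hc.ne_zero, fun f => by rw [key f, hcφ]⟩

/-- the `W(0,1)`-modules `Φ(λ,α,h)` and `Φ(μ,β,e)` are isomorphic
if and only if `λ = μ`, `α = β` and `h_n = e_n` for all `n ∈ ℤ`. -/
theorem stmt4 (lam mu : ℂ) (hlam : lam ≠ 0) (hmu : mu ≠ 0) (α β : ℂ) (h e : ℕ →₀ ℂ) :
    (∃ φ : R2 ≃ₗ[ℂ] R2,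
      (∀ m : ℤ, φ.toLinearMap ∘ₗ PhiL 1 lam α h m = PhiL 1 mu β e m ∘ₗ φ.toLinearMap) ∧
      (∀ m : ℤ, φ.toLinearMap ∘ₗ PhiW 1 lam α m = PhiW 1 mu β m ∘ₗ φ.toLinearMap))
      ↔ (lam = mu ∧ α = β ∧ ∀ n : ℤ, hpol 1 α h n = hpol 1 β e n) := by
  constructor
  · rintro ⟨φ, hL, hW⟩
    replace hL : ∀ m f, φ (PhiL 1 lam α h m f) = PhiL 1 mu β e m (φ f) :=
      fun m f => LinearMap.congr_fun (hL m) f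
    replace hW : ∀ m f, φ (PhiW 1 lam α m f) = PhiW 1 mu β m (φ f) :=
      fun m f => LinearMap.congr_fun (hW m) f
    obtain ⟨c, hc, hφ⟩ := exists_C_mul_of_linearEquiv φ fun i f => by
      fin_cases i
      · simpa [PhiL_zero_apply] using hL 0 f
      · simpa [PhiW_one_zero_apply] using hW 0 f
    have hC : (C c : R2) ≠ 0 := C_ne_zero.mpr hc
    have hW1 : C lam * (X 1 - C α) = (C mu * (X 1 - C β) : R2) := by
      have := hW 1 (C 1)
      rw [hφ, hφ, ← C_mul, one_mul, PhiW_apply_C, PhiW_apply_C] at this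
      simpa [wcoef_one_of_ne, hC] using this
    have heval : ∀ x : ℂ, lam * (x - α) = mu * (x - β) := fun x => by
      simpa using congrArg (eval fun _ => x) hW1
    have hlm : lam = mu := by linear_combination heval 1 - heval 0
    subst hlm
    have hαβ : α = β := by
      have := mul_left_cancel₀ hlam (heval 0)
      linear_combination -this
    refine ⟨rfl, hαβ, fun n => ?_⟩
    have := hL n (C 1)
    rw [hφ, hφ, ← C_mul, one_mul, PhiL_apply_C, PhiL_apply_C, C_1, mul_one] at this
    exact add_left_cancel
      (mul_left_cancel₀ (C_ne_zero.mpr (zpow_ne_zero n hlam)) (mul_right_cancel₀ hC this))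
  · rintro ⟨rfl, rfl, he⟩
    exact ⟨LinearEquiv.refl ℂ R2, fun m => by simp only [PhiL, he]; rfl, fun m => rfl⟩
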